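/- Let f be a WG-drawing with witness set P ⊆ ℝ² of a finite complete bipartite graph G with color map c, and assume the image of f and P are linearly separable. Let u0, u1, v0, v1 be four distinct vertices with c(u0) = c(v0), c(u1) = c(v1), and c(u0) ≠ c(u1) (so u0u1 and v0v1 are edges of G while u0v0 and u1v1 are non-edges, forming an alternating 4-cycle). Then the closed segments [f(u0), f(u1)] and [f(v0), f(v1)] are disjoint, and the open segments (f(u0), f(v0)) and (f(u1), f(v1)) intersect. -/

import Mathlib

noncomputable section

/-- The Euclidean plane. -/
abbrev Pt : Type := EuclideanSpace ℝ (Fin 2)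

/-- The Gabriel disk `D[u,v]`: the closed disk having `u` and `v` as antipodal points. -/
def gabrielDisk (u v : Pt) : Set Pt := Metric.closedBall (midpoint ℝ u v) (dist u v / 2)

/-- `f` is a witness Gabriel drawing of the finite simple graph `G` with witness set `P`. -/
def IsWGDrawing {V : Type*} [Fintype V] (G : SimpleGraph V) (f : V → Pt) (P : Set Pt) : Prop :=
  Function.Injective f ∧ Disjoint (Set.range f) P ∧
    ∀ u v : V, u ≠ v → (G.Adj u v ↔ gabrielDisk (f u) (f v) ∩ P = ∅)

/-- `⟨f₀, f₁⟩` is a mutual witness Gabriel drawing of the pair `⟨G₀, G₁⟩`. -/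
def IsMWGDrawing {V₀ V₁ : Type*} [Fintype V₀] [Fintype V₁]
    (G₀ : SimpleGraph V₀) (G₁ : SimpleGraph V₁) (f₀ : V₀ → Pt) (f₁ : V₁ → Pt) : Prop :=
  Function.Injective f₀ ∧ Function.Injective f₁ ∧
    Disjoint (Set.range f₀) (Set.range f₁) ∧
    (∀ u v : V₀, u ≠ v → (G₀.Adj u v ↔ gabrielDisk (f₀ u) (f₀ v) ∩ Set.range f₁ = ∅)) ∧
    (∀ u v : V₁, u ≠ v → (G₁.Adj u v ↔ gabrielDisk (f₁ u) (f₁ v) ∩ Set.range f₀ = ∅))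

/-- Two subsets of the plane are linearly separable. -/
def LinSep (A B : Set Pt) : Prop :=
  ∃ (φ : Pt →ₗ[ℝ] ℝ) (c : ℝ), φ ≠ 0 ∧ (∀ a ∈ A, φ a < c) ∧ ∀ b ∈ B, c < φ b

open scoped RealInnerProductSpace

lemma inner_pt (u v : Pt) : ⟪u, v⟫ = u 0 * v 0 + u 1 * v 1 := by
  simp [PiLp.inner_apply, Fin.sum_univ_two]; ring

lemma mem_gabrielDisk_iff (p u v : Pt) : p ∈ gabrielDisk u v ↔ ⟪u - p, v - p⟫ ≤ 0 := by
  rw [gabrielDisk, Metric.mem_closedBall, ← abs_of_nonneg (dist_nonneg (x := p)),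
    ← abs_of_nonneg (div_nonneg (dist_nonneg (x := u) (y := v)) zero_le_two), ← sq_le_sq,
    div_pow, EuclideanSpace.dist_eq, EuclideanSpace.dist_eq, Real.sq_sqrt (by positivity),
    Real.sq_sqrt (by positivity), inner_pt]
  simp only [Fin.sum_univ_two, Real.dist_eq, sq_abs, midpoint_eq_smul_add, PiLp.smul_apply,
    PiLp.add_apply, PiLp.sub_apply, smul_eq_mul, invOf_eq_inv]
  constructor <;> intro h <;> linarith

/-- A vector making acute angles with both of two vectors at a non-acute angle lies strictly
inside the cone they span. -/
lemma exists_pos_combination {A B C : Pt} (hAB : ⟪A, B⟫ ≤ 0) (hAC : 0 < ⟪A, C⟫)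
    (hBC : 0 < ⟪B, C⟫) : ∃ α β : ℝ, 0 < α ∧ 0 < β ∧ C = α • A + β • B := by
  have hA : 0 < ⟪A, A⟫ := real_inner_self_pos.2 (by rintro rfl; simp at hAC)
  have hB : 0 < ⟪B, B⟫ := real_inner_self_pos.2 (by rintro rfl; simp at hBC)
  simp only [inner_pt] at *
  set d := A 0 * B 1 - A 1 * B 0 with hd
  have hα : 0 < (C 0 * B 1 - C 1 * B 0) * d := by
    nlinarith [mul_pos hAC hB, mul_nonneg hBC.le (neg_nonneg.2 hAB)]
  have hβ : 0 < (A 0 * C 1 - A 1 * C 0) * d := by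
    nlinarith [mul_pos hBC hA, mul_nonneg hAC.le (neg_nonneg.2 hAB)]
  have hd0 : d ≠ 0 := by
    intro h
    simp [h] at hα
  refine ⟨(C 0 * B 1 - C 1 * B 0) * d / d ^ 2, (A 0 * C 1 - A 1 * C 0) * d / d ^ 2,
    by positivity, by positivity, ?_⟩
  ext i
  fin_cases i <;> simp <;> field_simp <;> rw [hd] <;> ring

lemma linearIndependent_of_inner {A B C : Pt} (hAB : ⟪A, B⟫ ≤ 0) (hAC : 0 < ⟪A, C⟫)
    (hBC : 0 < ⟪B, C⟫) : LinearIndependent ℝ ![A, B] := by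
  rw [LinearIndependent.pair_iff]
  intro s t h
  have hA : 0 < ⟪A, A⟫ := real_inner_self_pos.2 (by rintro rfl; simp at hAC)
  have hB : 0 < ⟪B, B⟫ := real_inner_self_pos.2 (by rintro rfl; simp at hBC)
  have h0 := congrArg (fun v : Pt => v 0) h
  have h1 := congrArg (fun v : Pt => v 1) h
  simp only [inner_pt, PiLp.add_apply, PiLp.smul_apply, smul_eq_mul, PiLp.zero_apply] at *
  have hd : A 0 * B 1 - A 1 * B 0 ≠ 0 := by
    intro hd
    have : 0 < (C 0 * B 1 - C 1 * B 0) * (A 0 * B 1 - A 1 * B 0) := by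
      nlinarith [mul_pos hAC hB, mul_nonneg hBC.le (neg_nonneg.2 hAB)]
    simp [hd] at this
  constructor
  · apply (mul_eq_zero.1 _).resolve_right hd
    linear_combination B 1 * h0 - B 0 * h1
  · apply (mul_eq_zero.1 _).resolve_right hd
    linear_combination A 0 * h1 - A 1 * h0

lemma exists_combination {A B : Pt} (h : LinearIndependent ℝ ![A, B]) (C : Pt) :
    ∃ x y : ℝ, C = x • A + y • B := by
  have hs := h.span_eq_top_of_card_eq_finrank (by simp)
  have hC : C ∈ Submodule.span ℝ (Set.range ![A, B]) := hs ▸ Submodule.mem_top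
  rw [Matrix.range_cons_cons_empty, Submodule.mem_span_pair] at hC
  obtain ⟨x, y, h⟩ := hC
  exact ⟨x, y, h.symm⟩

lemma LinearIndependent.eq_and_eq_of_pair {A B : Pt} (h : LinearIndependent ℝ ![A, B])
    {s t s' t' : ℝ} (e : s • A + t • B = s' • A + t' • B) : s = s' ∧ t = t' := by
  have := LinearIndependent.pair_iff.1 h (s - s') (t - t') (by
    linear_combination (norm := module) e)
  exact ⟨sub_eq_zero.1 this.1, sub_eq_zero.1 this.2⟩

/-- If, seen from `p`, the points `x` and `y` lie strictly inside the angle `a p b`, on different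
sides of the line `ab`, then `ab` and `xy` are the diagonals of a convex quadrilateral. -/
lemma diagonals_cross {p a b x y : Pt} {α β γ δ : ℝ} (hα : 0 < α) (hβ : 0 < β) (hγ : 0 < γ)
    (hδ : 0 < δ) (hind : LinearIndependent ℝ ![a - p, b - p])
    (hx : x - p = α • (a - p) + β • (b - p)) (hy : y - p = γ • (a - p) + δ • (b - p))
    (h : (α + β - 1) * (γ + δ - 1) < 0) :
    Disjoint (segment ℝ a x) (segment ℝ b y) ∧
      (openSegment ℝ a b ∩ openSegment ℝ x y).Nonempty := by
  constructor
  · rw [Set.disjoint_left]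
    rintro z ⟨s', s, hs', hs, hss, rfl⟩ ⟨t', t, ht', ht, htt, hz⟩
    obtain rfl : s' = 1 - s := by linarith
    obtain rfl : t' = 1 - t := by linarith
    obtain ⟨e₁, e₂⟩ := hind.eq_and_eq_of_pair
      (s := 1 - s + s * α) (t := s * β) (s' := t * γ) (t' := 1 - t + t * δ) (by
        linear_combination (norm := module) -hz - s • hx + t • hy)
    have e : s * (α + β - 1) = t * (γ + δ - 1) := by linarith
    have ht0 : t = 0 := by
      by_contra hne
      have : 0 < t := lt_of_le_of_ne ht (Ne.symm hne)
      nlinarith [mul_nonneg hs (sq_nonneg (α + β - 1))]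
    subst ht0
    nlinarith
  · have key : ∀ {x y : Pt} {α β γ δ : ℝ}, 0 < α → 0 < β → 0 < γ → 0 < δ →
        x - p = α • (a - p) + β • (b - p) → y - p = γ • (a - p) + δ • (b - p) →
        α + β - 1 < 0 → 0 < γ + δ - 1 →
        (openSegment ℝ a b ∩ openSegment ℝ x y).Nonempty := by
      intro x y α β γ δ hα hβ hγ hδ hx hy h₁ h₂
      set u := α + β - 1 with hu
      set v := γ + δ - 1 with hv
      have hvu : 0 < v - u := by linarith
      have hu' : 0 < -u := by linarith
      refine ⟨(v / (v - u)) • x + (-u / (v - u)) • y,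
        ⟨(v * α + -u * γ) / (v - u), (v * β + -u * δ) / (v - u), by positivity, by positivity,
          ?_, ?_⟩, ⟨_, _, by positivity, by positivity, ?_, rfl⟩⟩
      · field_simp
        rw [hu, hv]
        ring
      · obtain rfl := sub_eq_iff_eq_add.1 hx
        obtain rfl := sub_eq_iff_eq_add.1 hy
        match_scalars <;> field_simp <;> grind
      · field_simp
        ring
    rcases mul_neg_iff.1 h with ⟨h₁, h₂⟩ | ⟨h₁, h₂⟩
    · rw [openSegment_symm ℝ x y]
      exact key hγ hδ hα hβ hy hx h₂ h₁
    · exact key hα hβ hγ hδ hx hy h₁ h₂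

/-- The point `p` lies in the Gabriel disk of `a, b` but in none of the Gabriel disks
of the pairs joining `{a, b}` to `{x, y}`. -/
structure IsPrivateWitness (p a b x y : Pt) : Prop where
  inner_nonpos : ⟪a - p, b - p⟫ ≤ 0
  inner_ax : 0 < ⟪a - p, x - p⟫
  inner_ay : 0 < ⟪a - p, y - p⟫
  inner_bx : 0 < ⟪b - p, x - p⟫
  inner_by : 0 < ⟪b - p, y - p⟫

namespace IsPrivateWitness

variable {p q a b x y : Pt}

lemma linearIndependent (h : IsPrivateWitness p a b x y) :
    LinearIndependent ℝ ![a - p, b - p] :=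
  linearIndependent_of_inner h.inner_nonpos h.inner_ax h.inner_bx

lemma inner_pos (h : IsPrivateWitness p a b x y) : 0 < ⟪x - p, y - p⟫ := by
  obtain ⟨α, β, hα, hβ, hx⟩ := exists_pos_combination h.inner_nonpos h.inner_ax h.inner_bx
  rw [hx, inner_add_left, real_inner_smul_left, real_inner_smul_left]
  exact add_pos (mul_pos hα h.inner_ay) (mul_pos hβ h.inner_by)

end IsPrivateWitness

/-- Coordinates of `q` in the frame `(p; a, b)`, when `x, y` are given in the frame `(p; a, b)`
and `a, b` in the frame `(q; x, y)`. -/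
lemma exists_coordinates {p q a b x y : Pt} {α β γ δ κ lam μ ν : ℝ}
    (hind : LinearIndependent ℝ ![a - p, b - p])
    (hx : x - p = α • (a - p) + β • (b - p)) (hy : y - p = γ • (a - p) + δ • (b - p))
    (ha : a - q = κ • (x - q) + lam • (y - q)) (hb : b - q = μ • (x - q) + ν • (y - q)) :
    ∃ s t : ℝ, q - p = s • (a - p) + t • (b - p) ∧
      1 + (κ + lam - 1) * s = κ * α + lam * γ ∧ (κ + lam - 1) * t = κ * β + lam * δ ∧
      (μ + ν - 1) * s = μ * α + ν * γ ∧ 1 + (μ + ν - 1) * t = μ * β + ν * δ := by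
  obtain ⟨s, t, hq⟩ := exists_combination hind (q - p)
  obtain ⟨e₁, e₂⟩ := hind.eq_and_eq_of_pair
    (s := 1 + (κ + lam - 1) * s) (t := (κ + lam - 1) * t)
    (s' := κ * α + lam * γ) (t' := κ * β + lam * δ) (by
      linear_combination (norm := module) ha + κ • hx + lam • hy - (κ + lam - 1) • hq)
  obtain ⟨e₃, e₄⟩ := hind.eq_and_eq_of_pair
    (s := (μ + ν - 1) * s) (t := 1 + (μ + ν - 1) * t)
    (s' := μ * α + ν * γ) (t' := μ * β + ν * δ) (by
      linear_combination (norm := module) hb + μ • hx + ν • hy - (μ + ν - 1) • hq)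
  exact ⟨s, t, hq, e₁, e₂, e₃, e₄⟩

/-- A triangle with a non-acute angle at `p` is contained in the Gabriel disk of the side
opposite to `p`. -/
lemma inner_nonpos_of_mem_triangle {p q a b : Pt} {s t : ℝ} (hs : 0 ≤ s) (ht : 0 ≤ t)
    (hst : s + t ≤ 1) (hq : q - p = s • (a - p) + t • (b - p)) (h : ⟪a - p, b - p⟫ ≤ 0) :
    ⟪a - q, b - q⟫ ≤ 0 := by
  have e₁ : a - q = (1 - s) • (a - p) - t • (b - p) := by
    linear_combination (norm := module) -hq
  have e₂ : b - q = (1 - t) • (b - p) - s • (a - p) := by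
    linear_combination (norm := module) -hq
  rw [e₁, e₂]
  generalize a - p = A at *
  generalize b - p = B at *
  simp only [inner_sub_left, inner_sub_right, real_inner_smul_left, real_inner_smul_right,
    real_inner_comm A B]
  have hA : 0 ≤ ⟪A, A⟫ := real_inner_self_nonneg
  have hB : 0 ≤ ⟪B, B⟫ := real_inner_self_nonneg
  have hs' : 0 ≤ 1 - s := by linarith
  have ht' : 0 ≤ 1 - t := by linarith
  have := mul_nonneg (mul_nonneg hs' hs) hA
  have := mul_nonneg (mul_nonneg ht' ht) hB
  have := mul_nonneg (add_nonneg (mul_nonneg hs' ht') (mul_nonneg hs ht)) (neg_nonneg.2 h)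
  linarith

/-- It is impossible that `x, y` lie in the triangle `p a b` while `a, b` lie beyond
the line `xy` as seen from `q`. -/
lemma false_of_inside_of_beyond {p q a b x y : Pt} {α β γ δ κ lam μ ν : ℝ}
    (hα : 0 < α) (hβ : 0 < β) (hγ : 0 < γ) (hδ : 0 < δ)
    (hκ : 0 < κ) (hlam : 0 < lam) (hμ : 0 < μ) (hν : 0 < ν)
    (hp : IsPrivateWitness p a b x y) (hq : IsPrivateWitness q x y a b)
    (hx : x - p = α • (a - p) + β • (b - p)) (hy : y - p = γ • (a - p) + δ • (b - p))
    (ha : a - q = κ • (x - q) + lam • (y - q)) (hb : b - q = μ • (x - q) + ν • (y - q))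
    (h₁ : α + β - 1 ≤ 0) (h₂ : γ + δ - 1 ≤ 0) (h₃ : 0 ≤ κ + lam - 1) (h₄ : 0 ≤ μ + ν - 1) :
    False := by
  obtain ⟨s, t, hqp, e₁, e₂, e₃, e₄⟩ := exists_coordinates hp.linearIndependent hx hy ha hb
  have ht : 0 < t := pos_of_mul_pos_right (a := κ + lam - 1) (e₂ ▸ by positivity) h₃
  have hs : 0 < s := pos_of_mul_pos_right (a := μ + ν - 1) (e₃ ▸ by positivity) h₄
  have h₃' : 0 < κ + lam - 1 := pos_of_mul_pos_left (b := t) (e₂ ▸ by positivity) ht.le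
  have hst : s + t ≤ 1 := by
    by_contra! hst
    have := mul_pos h₃' (sub_pos.2 hst)
    have := mul_nonneg hκ.le (neg_nonneg.2 h₁)
    have := mul_nonneg hlam.le (neg_nonneg.2 h₂)
    linarith
  exact hq.inner_pos.not_ge (inner_nonpos_of_mem_triangle hs.le ht.le hst hqp hp.inner_nonpos)

lemma apply_combination (φ : Pt →ₗ[ℝ] ℝ) (c : ℝ) {p a b x : Pt} {α β : ℝ}
    (hx : x - p = α • (a - p) + β • (b - p)) :
    c - φ x = α * (c - φ a) + β * (c - φ b) + (α + β - 1) * (φ p - c) := by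
  have := congrArg φ hx
  simp only [map_add, map_sub, map_smul, smul_eq_mul] at this
  linear_combination -this

lemma min_le_combination {α β A B : ℝ} (hα : 0 ≤ α) (hβ : 0 ≤ β) (h : 0 ≤ α + β - 1)
    (hA : 0 ≤ A) (hB : 0 ≤ B) : min A B ≤ α * A + β * B := by
  have := mul_le_mul_of_nonneg_left (min_le_left A B) hα
  have := mul_le_mul_of_nonneg_left (min_le_right A B) hβ
  have := mul_nonneg h (le_min hA hB)
  linarith

lemma combination_le_max {α β A B : ℝ} (hα : 0 ≤ α) (hβ : 0 ≤ β) (h : α + β - 1 ≤ 0)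
    (hA : 0 ≤ A) : α * A + β * B ≤ max A B := by
  have := mul_le_mul_of_nonneg_left (le_max_left A B) hα
  have := mul_le_mul_of_nonneg_left (le_max_right A B) hβ
  have := mul_nonneg (neg_nonneg.2 h) (hA.trans (le_max_left A B))
  linarith

/-- The two diagonals of an alternating 4-cycle cross and its two edges are disjoint. -/
lemma alternating_cycle {p q a b x y : Pt} (hp : IsPrivateWitness p a b x y)
    (hq : IsPrivateWitness q x y a b) (φ : Pt →ₗ[ℝ] ℝ) (c : ℝ) (ha : φ a < c) (hb : φ b < c)
    (hx : φ x < c) (hy : φ y < c) (hpc : c < φ p) (hqc : c < φ q) :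
    Disjoint (segment ℝ a x) (segment ℝ b y) ∧
      (openSegment ℝ a b ∩ openSegment ℝ x y).Nonempty := by
  obtain ⟨α, β, hα, hβ, ex⟩ := exists_pos_combination hp.inner_nonpos hp.inner_ax hp.inner_bx
  obtain ⟨γ, δ, hγ, hδ, ey⟩ := exists_pos_combination hp.inner_nonpos hp.inner_ay hp.inner_by
  obtain ⟨κ, lam, hκ, hlam, ea⟩ :=
    exists_pos_combination hq.inner_nonpos hq.inner_ax hq.inner_bx
  obtain ⟨μ, ν, hμ, hν, eb⟩ := exists_pos_combination hq.inner_nonpos hq.inner_ay hq.inner_by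
  rcases lt_or_ge ((α + β - 1) * (γ + δ - 1)) 0 with h | h
  · exact diagonals_cross hα hβ hγ hδ hp.linearIndependent ex ey h
  rcases lt_or_ge ((κ + lam - 1) * (μ + ν - 1)) 0 with h' | h'
  · have := diagonals_cross hκ hlam hμ hν hq.linearIndependent ea eb h'
    rwa [segment_symm ℝ x a, segment_symm ℝ y b, Set.inter_comm] at this
  exfalso
  obtain ⟨s, t, -, e₁, e₂, e₃, e₄⟩ := exists_coordinates hp.linearIndependent ex ey ea eb
  have hk₁ : κ + lam - 1 ≠ 0 := fun h0 => by
    rw [h0, zero_mul] at e₂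
    exact absurd e₂ (by positivity)
  have hk₂ : μ + ν - 1 ≠ 0 := fun h0 => by
    rw [h0, zero_mul] at e₃
    exact absurd e₃ (by positivity)
  have fx := apply_combination φ c ex
  have fy := apply_combination φ c ey
  have fa := apply_combination φ c ea
  have fb := apply_combination φ c eb
  rw [← sub_pos] at ha hb hx hy hpc hqc
  rcases mul_nonneg_iff.1 h with ⟨h₁, h₂⟩ | ⟨h₁, h₂⟩ <;>
    rcases mul_nonneg_iff.1 h' with ⟨h₃, h₄⟩ | ⟨h₃, h₄⟩
  · have m₁ := mul_nonneg h₁ hpc.le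
    have m₂ := mul_nonneg h₂ hpc.le
    have m₃ := mul_pos (lt_of_le_of_ne h₃ hk₁.symm) hqc
    have m₄ := mul_pos (lt_of_le_of_ne h₄ hk₂.symm) hqc
    have nx := min_le_combination hα.le hβ.le h₁ ha.le hb.le
    have ny := min_le_combination hγ.le hδ.le h₂ ha.le hb.le
    have na := min_le_combination hκ.le hlam.le h₃ hx.le hy.le
    have nb := min_le_combination hμ.le hν.le h₄ hx.le hy.le
    exact absurd (le_min (by linarith) (by linarith) :
      min (c - φ a) (c - φ b) ≤ min (c - φ x) (c - φ y))
      (lt_min (by linarith) (by linarith)).not_ge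
  · exact false_of_inside_of_beyond hκ hlam hμ hν hα hβ hγ hδ hq hp ea eb ex ey h₃ h₄ h₁ h₂
  · exact false_of_inside_of_beyond hα hβ hγ hδ hκ hlam hμ hν hp hq ex ey ea eb h₁ h₂ h₃ h₄
  · have m₁ := mul_nonneg (neg_nonneg.2 h₁) hpc.le
    have m₂ := mul_nonneg (neg_nonneg.2 h₂) hpc.le
    have m₃ := mul_pos (neg_pos.2 (lt_of_le_of_ne h₃ hk₁)) hqc
    have m₄ := mul_pos (neg_pos.2 (lt_of_le_of_ne h₄ hk₂)) hqc
    have nx := combination_le_max (B := c - φ b) hα.le hβ.le h₁ ha.le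
    have ny := combination_le_max (B := c - φ b) hγ.le hδ.le h₂ ha.le
    have na := combination_le_max (B := c - φ y) hκ.le hlam.le h₃ hx.le
    have nb := combination_le_max (B := c - φ y) hμ.le hν.le h₄ hx.le
    exact absurd (max_le (by linarith) (by linarith) :
      max (c - φ x) (c - φ y) ≤ max (c - φ a) (c - φ b))
      (max_lt (by linarith) (by linarith)).not_ge

/-- Lemma 2: in a linearly separable WG-drawing of a complete bipartite graph, the two
edges of an alternating 4-cycle do not cross and the two non-edges do cross. -/
theorem stmt5 {V : Type*} [Fintype V] (G : SimpleGraph V) (c : V → Bool)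
    (hbip : ∀ u v : V, u ≠ v → (G.Adj u v ↔ c u ≠ c v))
    (f : V → Pt) (P : Set Pt) (hWG : IsWGDrawing G f P)
    (hsep : LinSep (Set.range f) P)
    (u₀ u₁ v₀ v₁ : V)
    (h01 : u₀ ≠ u₁) (h02 : u₀ ≠ v₀) (h03 : u₀ ≠ v₁)
    (h12 : u₁ ≠ v₀) (h13 : u₁ ≠ v₁) (h23 : v₀ ≠ v₁)
    (hc0 : c u₀ = c v₀) (hc1 : c u₁ = c v₁) (hc01 : c u₀ ≠ c u₁) :
    Disjoint (segment ℝ (f u₀) (f u₁)) (segment ℝ (f v₀) (f v₁)) ∧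
      (openSegment ℝ (f u₀) (f v₀) ∩ openSegment ℝ (f u₁) (f v₁)).Nonempty := by
  obtain ⟨-, -, hadj⟩ := hWG
  obtain ⟨φ, r, -, hφ, hφP⟩ := hsep
  have edge : ∀ {u v : V}, c u ≠ c v → ∀ p ∈ P, 0 < ⟪f u - p, f v - p⟫ := by
    intro u v huv p hp
    have hne : u ≠ v := ne_of_apply_ne c huv
    by_contra! hle
    have hmem : p ∈ gabrielDisk (f u) (f v) ∩ P := ⟨(mem_gabrielDisk_iff ..).2 hle, hp⟩
    rw [(hadj u v hne).1 ((hbip u v hne).2 huv)] at hmem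
    exact hmem
  have nonedge : ∀ {u v : V}, u ≠ v → c u = c v → ∃ p ∈ P, ⟪f u - p, f v - p⟫ ≤ 0 := by
    intro u v hne huv
    have hnonempty : gabrielDisk (f u) (f v) ∩ P ≠ ∅ := fun h =>
      (hbip u v hne).1 ((hadj u v hne).2 h) huv
    obtain ⟨p, hpD, hpP⟩ := Set.nonempty_iff_ne_empty.2 hnonempty
    exact ⟨p, hpP, (mem_gabrielDisk_iff ..).1 hpD⟩
  obtain ⟨p, hpP, hp⟩ := nonedge h02 hc0
  obtain ⟨q, hqP, hq⟩ := nonedge h13 hc1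
  have c₁ : c u₀ ≠ c v₁ := hc1 ▸ hc01
  have c₂ : c v₀ ≠ c u₁ := hc0 ▸ hc01
  have c₃ : c v₀ ≠ c v₁ := hc1 ▸ c₂
  exact alternating_cycle
    ⟨hp, edge hc01 p hpP, edge c₁ p hpP, edge c₂ p hpP, edge c₃ p hpP⟩
    ⟨hq, edge hc01.symm q hqP, edge c₂.symm q hqP, edge c₁.symm q hqP, edge c₃.symm q hqP⟩
    φ r (hφ _ ⟨_, rfl⟩) (hφ _ ⟨_, rfl⟩) (hφ _ ⟨_, rfl⟩) (hφ _ ⟨_, rfl⟩) (hφP p hpP) (hφP q hqP)
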